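/- arXiv:2312.11183 — 3 statements merged into one kernel-verified Lean document; each statement's English description precedes it below -/
import Mathlib

section
/- For fixed q ∈ (0,1), the ratio of consecutive coefficients of f_0(x) = (1-q)/(e^{(q-1)x} - q) satisfies [x^{n+1}] f_0 / [x^n] f_0 → (1-q)/log(1/q) as n → ∞. -/
open Filter

/-- The `n`-th Taylor coefficient at `0` of `f₀(x) = (1-q)/(e^{(q-1)x} - q)`. -/
noncomputable def coeffF0 (q : ℝ) (n : ℕ) : ℝ :=
  iteratedDeriv n (fun x : ℝ => (1 - q) / (Real.exp ((q - 1) * x) - q)) 0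
    / (n.factorial : ℝ)

lemma aux_h (q : ℝ) (hq0 : 0 < q) (hq1 : q < 1) (R : ℝ) (hR : R = Real.log (1/q) / (1-q)) :
    ∃ (b : ℕ → ℝ) (h : ℝ → ℝ), h R ≠ 0 ∧ (∀ x, |x| ≤ R → HasSum (fun n => b n * x ^ n) (h x)) ∧
      ∀ x, x ≠ R → h x = (R - x) * ((1 - q) / (Real.exp ((q - 1) * x) - q)) := by
  have h1q : 0 < 1 - q := by linarith
  have hRpos : 0 < R := by
    rw [hR]; exact div_pos (Real.log_pos (by rw [lt_div_iff₀ hq0]; linarith)) h1q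
  have hqR : (q - 1) * R = Real.log q := by
    rw [hR, one_div, Real.log_inv]; field_simp; ring
  set D : ℂ → ℂ := fun z => Complex.exp ((q - 1) * z) - q with hD
  have hDd : Differentiable ℂ D := by fun_prop
  have hexpR : Complex.exp ((q - 1) * (R:ℂ)) = q := by
    have : ((q:ℂ) - 1) * (R:ℂ) = ((Real.log q : ℝ) : ℂ) := by rw [← hqR]; push_cast; ring
    rw [this, ← Complex.ofReal_exp, Real.exp_log hq0]
  have hDR : D R = 0 := by simp [hD, hexpR]
  have hder : deriv D R = q * (q - 1) := by
    have : HasDerivAt D (Complex.exp ((q - 1) * (R:ℂ)) * ((q - 1) * 1)) R :=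
      (((hasDerivAt_id (R:ℂ)).const_mul ((q:ℂ) - 1)).cexp).sub_const _
    rw [this.deriv, hexpR]; ring
  have hqc : (q:ℂ) ≠ 0 := by exact_mod_cast hq0.ne'
  have hqc1 : (q:ℂ) - 1 ≠ 0 := by
    rw [sub_ne_zero]; exact_mod_cast hq1.ne
  set E : ℂ → ℂ := dslope D R with hE
  have hEd : Differentiable ℂ E := by
    rw [← differentiableOn_univ]
    exact (Complex.differentiableOn_dslope (by simp)).2 hDd.differentiableOn
  have hDE : ∀ z, (z - R) * E z = D z := by
    intro z
    have := sub_smul_dslope D (R:ℂ) z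
    rw [hDR, sub_zero] at this
    simpa using this
  set r : ℝ := Real.sqrt (R^2 + (2 * Real.pi / (1 - q))^2) with hr
  have hRr : R < r := by
    rw [hr]; apply Real.lt_sqrt_of_sq_lt
    have : 0 < 2 * Real.pi / (1 - q) := by positivity
    nlinarith
  have hE0 : ∀ z, z ∈ Metric.ball (0:ℂ) r → E z ≠ 0 := by
    intro z hz hEz
    by_cases hzR : z = R
    · rw [hzR, hE, dslope_same, hder] at hEz
      exact mul_ne_zero hqc hqc1 hEz
    · have h0 : D z = 0 := by rw [← hDE, hEz, mul_zero]
      have h1 : Complex.exp ((q - 1) * z) = Complex.exp ((q - 1) * R) := by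
        rw [hexpR]; exact sub_eq_zero.1 h0
      obtain ⟨n, hn⟩ := Complex.exp_eq_exp_iff_exists_int.1 h1
      have hre := congrArg Complex.re hn
      have him := congrArg Complex.im hn
      simp at hre him
      have hre' : z.re = R := by
        rcases hre with h | h
        · exact h
        · linarith
      have hn0 : n ≠ 0 := by
        rintro rfl
        apply hzR
        simp at hn
        rcases hn with h | h
        · exact h
        · exact absurd h hqc1
      have hz2 : z.re^2 + z.im^2 < R^2 + (2 * Real.pi / (1 - q))^2 := by
        rw [mem_ball_zero_iff, hr, Complex.norm_eq_sqrt_sq_add_sq] at hz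
        exact (Real.sqrt_lt_sqrt_iff (by positivity)).1 hz
      rw [hre'] at hz2
      have hzim : z.im = - n * (2 * Real.pi / (1 - q)) := by
        field_simp; linarith
      have hn1 : (1:ℝ) ≤ (n:ℝ)^2 := by
        have : (1:ℤ) ≤ n^2 := by have := pow_pos (abs_pos.2 hn0) 2; rw [sq_abs] at this; omega
        exact_mod_cast this
      rw [hzim] at hz2
      have : 0 ≤ (2 * Real.pi / (1 - q))^2 := sq_nonneg _
      nlinarith
  set H : ℂ → ℂ := fun z => (q - 1) / E z with hH
  have hHd : DifferentiableOn ℂ H (Metric.ball 0 r) :=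
    (differentiableOn_const _).div hEd.differentiableOn hE0
  have key : ∀ x : ℝ, x ≠ R → H x = ((R - x) * ((1 - q) / (Real.exp ((q - 1) * x) - q)) : ℝ) := by
    intro x hx
    have hx' : (x:ℂ) - R ≠ 0 := by rw [sub_ne_zero]; exact_mod_cast hx
    have : E x = D x / (x - R) := by rw [← hDE]; field_simp
    simp only [hH]
    rw [this, hD]; push_cast
    rw [div_div_eq_mul_div, ← mul_div_assoc]; congr 1; ring
  refine ⟨fun n => (((n.factorial : ℂ)⁻¹ * iteratedDeriv n H 0)).re, fun x => (H x).re, ?_, ?_, ?_⟩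
  · have : H R = ((1/q : ℝ) : ℂ) := by
      simp only [hH, hE, dslope_same, hder]; push_cast; field_simp
    simp only [this, Complex.ofReal_re]; positivity
  · intro x hx
    have := Complex.hasSum_taylorSeries_on_ball hHd (z := (x:ℂ)) (by
      rw [mem_ball_zero_iff]; simpa using lt_of_le_of_lt hx hRr)
    have := Complex.hasSum_re this
    convert this using 2 with n
    simp only [smul_eq_mul, sub_zero]
    rw [← Complex.re_mul_ofReal]
    congr 1; push_cast; ring
  · intro x hx
    simp only [key x hx, Complex.ofReal_re]

/-- For fixed `q ∈ (0,1)`, `[x^{n+1}] f₀ / [x^n] f₀ → (1-q)/log(1/q)` as `n → ∞`. -/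
theorem coeff_f0_ratio (q : ℝ) (hq0 : 0 < q) (hq1 : q < 1) :
    Tendsto (fun n : ℕ => coeffF0 q (n + 1) / coeffF0 q n) atTop
      (nhds ((1 - q) / Real.log (1 / q))) := by
  obtain ⟨R, hR⟩ : ∃ R, R = Real.log (1/q) / (1-q) := ⟨_, rfl⟩
  obtain ⟨b, h, hhR, hsum, hh⟩ := aux_h q hq0 hq1 R hR
  have h1q : 0 < 1 - q := by linarith
  have hRpos : 0 < R := by
    rw [hR]; exact div_pos (Real.log_pos (by rw [lt_div_iff₀ hq0]; linarith)) h1q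
  set f : ℝ → ℝ := fun x : ℝ => (1 - q) / (Real.exp ((q - 1) * x) - q) with hf
  set s : ℕ → ℝ := fun n => ∑ k ∈ Finset.range (n+1), b k * R ^ k with hs
  set p : FormalMultilinearSeries ℝ ℝ ℝ :=
    FormalMultilinearSeries.ofScalars ℝ (fun n => s n / R^(n+1)) with hp
  have hfp : HasFPowerSeriesAt f p 0 := by
    rw [hasFPowerSeriesAt_iff]
    filter_upwards [Metric.ball_mem_nhds (0:ℝ) hRpos] with x hx
    rw [mem_ball_zero_iff, Real.norm_eq_abs] at hx
    have hxR : x ≠ R := fun e => by rw [e, abs_of_pos hRpos] at hx; exact lt_irrefl _ hx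
    have h1 := hsum x hx.le
    have hlt : |x / R| < 1 := by rw [abs_div, abs_of_pos hRpos, div_lt_one hRpos]; exact hx
    have h2 : HasSum (fun n => (x/R)^n * R⁻¹) ((1 - x/R)⁻¹ * R⁻¹) :=
      (hasSum_geometric_of_abs_lt_one hlt).mul_right _
    have h3 := hasSum_sum_range_mul_of_summable_norm h1.summable.norm h2.summable.norm
    rw [h1.tsum_eq, h2.tsum_eq, hh x hxR] at h3
    have hne : R - x ≠ 0 := sub_ne_zero.2 hxR.symm
    have e1 : (fun n => x ^ n • p.coeff n) =
        fun n => ∑ k ∈ Finset.range (n + 1), b k * x ^ k * ((x / R) ^ (n - k) * R⁻¹) := by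
      ext n
      simp only [hp, FormalMultilinearSeries.coeff_ofScalars, hs, smul_eq_mul]
      rw [← mul_div_assoc, Finset.mul_sum, Finset.sum_div]
      refine Finset.sum_congr rfl fun k hk => ?_
      obtain ⟨m, rfl⟩ := Nat.exists_eq_add_of_le (Nat.lt_succ_iff.1 (Finset.mem_range.1 hk))
      rw [Nat.add_sub_cancel_left, div_pow]
      field_simp
      ring
    have e2 : f (0 + x) = (R - x) * ((1 - q) / (Real.exp ((q - 1) * x) - q)) *
        ((1 - x / R)⁻¹ * R⁻¹) := by
      rw [zero_add]
      have : (1 - x/R)⁻¹ * R⁻¹ = (R - x)⁻¹ := by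
        rw [← mul_inv]; congr 1; field_simp
      rw [this, mul_comm (R - x), mul_assoc, mul_inv_cancel₀ hne, mul_one]
    rw [e1, e2]
    exact h3
  have hco : ∀ n, coeffF0 q n = s n / R^(n+1) := by
    intro n
    have h1 := hfp.analyticAt.hasFPowerSeriesAt.eq_formalMultilinearSeries hfp
    have h2 := congrArg (fun P => FormalMultilinearSeries.coeff P n) h1
    simpa [hp, FormalMultilinearSeries.coeff_ofScalars, coeffF0] using h2
  have hst : Tendsto s atTop (nhds (h R)) :=
    ((hsum R (abs_of_pos hRpos).le).tendsto_sum_nat).comp (tendsto_add_atTop_nat 1)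
  have hlim : Tendsto (fun n => s (n+1) / s n * R⁻¹) atTop (nhds (h R / h R * R⁻¹)) :=
    ((hst.comp (tendsto_add_atTop_nat 1)).div hst hhR).mul_const _
  rw [div_self hhR, one_mul, hR, inv_div] at hlim
  refine hlim.congr fun n => ?_
  have hR' : (1 - q) / Real.log (1 / q) = R⁻¹ := by rw [hR, inv_div]
  rw [hco, hco, hR']
  by_cases h0 : s n = 0
  · simp [h0]
  · field_simp
    ring
end

section
/- The exponential generating function A(x,q) = Σ_{n≥1} Σ_{T ∈ 𝔗_n} q^{d(T)} x^n/n! of rooted labelled trees weighted by descents satisfies, as a formal power series identity for fixed q ≠ 1, the implicit equation x = (e^{-q A(x,q)} − e^{-A(x,q)})/(1−q). -/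
open scoped Classical

/-- A rooted labelled tree on the vertex set `Fin n`, encoded by its root and its parent
function `p` (with the convention `p root = root`): every vertex reaches the root by
iterating `p`. -/
def IsRootedTree {n : ℕ} (root : Fin n) (p : Fin n → Fin n) : Prop :=
  p root = root ∧ ∀ v, ∃ k : ℕ, p^[k] v = root

/-- The number of descents of a rooted labelled tree: edges `{v, p v}` whose parent label
`p v` exceeds the child label `v`. -/
def treeDescentNum {n : ℕ} (p : Fin n → Fin n) : ℕ :=
  (Finset.univ.filter (fun v : Fin n => v < p v)).card

/-- `Y_{n,q} = Σ_{T ∈ 𝔗_n} q^{d(T)}`, the total descent weight of rooted labelled trees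
on `n` vertices; `n! [x^n] A(x,q) = Y_{n,q}`. -/
noncomputable def treeWeight (n : ℕ) (q : ℝ) : ℝ :=
  ∑ t ∈ Finset.univ.filter
      (fun t : Fin n × (Fin n → Fin n) => IsRootedTree t.1 t.2),
    q ^ treeDescentNum t.2

/-- Auxiliary matrix `1 - P`. -/
noncomputable def NN {n : ℕ} (r : Fin n) (p : Fin n → Fin n) : Matrix (Fin n) (Fin n) ℝ :=
  fun v => if v = r then Pi.single r 1 else Pi.single v 1 - Pi.single (p v) 1

lemma NN_tree {n : ℕ} (r : Fin n) (p : Fin n → Fin n) (hp : IsRootedTree r p) :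
    (NN r p).det = 1 := by
  obtain ⟨hr, hk⟩ := hp
  let dep : Fin n → ℕ := fun v => Nat.find (hk v)
  have hdep : ∀ v, v ≠ r → dep (p v) < dep v := by
    intro v hv
    have hs : p^[dep v] v = r := Nat.find_spec (hk v)
    rcases hd : dep v with _ | m
    · rw [hd] at hs; exact absurd hs hv
    · rw [hd, Function.iterate_succ_apply] at hs
      exact Nat.lt_succ_of_le (Nat.find_min' (hk (p v)) hs)
  have hent : ∀ v u, dep v ≤ dep u → NN r p v u = (1 : Matrix (Fin n) (Fin n) ℝ) v u := by
    intro v u hvu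
    by_cases hv : v = r
    · subst hv; simp [NN, Matrix.one_apply, Pi.single_apply, eq_comm]
    · have : u ≠ p v := by
        rintro rfl
        exact absurd (hdep v hv) (not_lt.mpr hvu)
      simp [NN, hv, Matrix.one_apply, Pi.single_apply, this, eq_comm]
  have hbt : (NN r p).BlockTriangular (fun v => OrderDual.toDual (dep v)) := by
    intro i j hij
    have hij' : dep i < dep j := hij
    rw [hent i j hij'.le, Matrix.one_apply_ne]
    rintro rfl; exact lt_irrefl _ hij'
  rw [hbt.det]
  refine Finset.prod_eq_one fun a _ => ?_
  have : (NN r p).toSquareBlock (fun v => OrderDual.toDual (dep v)) a = 1 := by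
    ext ⟨i, hi⟩ ⟨j, hj⟩
    have hij : dep i = dep j := OrderDual.toDual.injective (hi.trans hj.symm)
    simp only [Matrix.toSquareBlock_def, Matrix.of_apply]
    rw [hent i j hij.le]
    simp [Matrix.one_apply]
  rw [this, Matrix.det_one]

lemma NN_not_tree {n : ℕ} (r : Fin n) (p : Fin n → Fin n) (hr : p r = r)
    (hp : ¬ IsRootedTree r p) : (NN r p).det = 0 := by
  have : ∃ v, ∀ k : ℕ, p^[k] v ≠ r := by
    by_contra hc
    push Not at hc
    exact hp ⟨hr, hc⟩
  obtain ⟨v₀, hv₀⟩ := this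
  rw [← Matrix.exists_mulVec_eq_zero_iff]
  refine ⟨fun v => if ∀ k : ℕ, p^[k] v ≠ r then 1 else 0, ?_, ?_⟩
  · intro hc
    have := congrFun hc v₀
    simp [hv₀] at this
  · ext v
    by_cases hv : v = r
    · subst hv
      simp only [Matrix.mulVec, NN, if_true, single_dotProduct, Pi.zero_apply, one_mul]
      rw [if_neg]
      intro hc; exact hc 0 rfl
    · simp only [Matrix.mulVec, NN, hv, if_false, sub_dotProduct, single_dotProduct,
        Pi.zero_apply, one_mul]
      have : (∀ k : ℕ, p^[k] v ≠ r) ↔ (∀ k : ℕ, p^[k] (p v) ≠ r) := by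
        constructor
        · intro hc k; rw [← Function.iterate_succ_apply]; exact hc _
        · intro hc k
          rcases k with _ | k
          · exact hv
          · rw [Function.iterate_succ_apply]; exact hc k
      simp only [this, sub_self]

noncomputable def ww {n : ℕ} (q : ℝ) (v u : Fin n) : ℝ := if v < u then q else 1

noncomputable def LL (n : ℕ) (q : ℝ) : Matrix (Fin n) (Fin n) ℝ :=
  fun v => ∑ u, ww q v u • (Pi.single v 1 - Pi.single u 1)

lemma det_LL_root {n : ℕ} (q : ℝ) (r : Fin n) :
    ((LL n q).updateRow r (Pi.single r 1)).det =
      ∑ p : Fin n → Fin n, if IsRootedTree r p then q ^ treeDescentNum p else 0 := by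
  have hM : (LL n q).updateRow r (Pi.single r 1) = fun v => ∑ u,
      (if v = r then (if u = r then 1 else 0) else ww q v u : ℝ) •
        (if v = r then Pi.single r 1 else Pi.single v 1 - Pi.single u 1 : Fin n → ℝ) := by
    funext v
    by_cases hv : v = r
    · subst hv; simp
    · rw [Matrix.updateRow_ne hv]; simp [hv, LL]
  rw [hM]
  change Matrix.detRowAlternating.toMultilinearMap _ = _
  rw [MultilinearMap.map_sum]
  refine Finset.sum_congr rfl fun p _ => ?_
  refine (MultilinearMap.map_smul_univ Matrix.detRowAlternating.toMultilinearMap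
    (fun v => (if v = r then (if p v = r then 1 else 0) else ww q v (p v) : ℝ))
    (fun v => (if v = r then Pi.single r 1 else Pi.single v 1 - Pi.single (p v) 1 : Fin n → ℝ))).trans ?_
  change _ • (NN r p).det = _
  by_cases hr : p r = r
  · by_cases hp : IsRootedTree r p
    · rw [if_pos hp, NN_tree r p hp, smul_eq_mul, mul_one, treeDescentNum, Finset.card_eq_sum_ones,
        Finset.sum_filter, ← Finset.prod_pow_eq_pow_sum]
      refine Finset.prod_congr rfl fun v _ => ?_
      by_cases hv : v = r
      · subst hv; simp [hr]
      · simp only [hv, if_false, ww]; split_ifs <;> simp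
    · rw [if_neg hp, NN_not_tree r p hr hp, smul_zero]
  · rw [if_neg (fun h => hr h.1), Finset.prod_eq_zero (Finset.mem_univ r), zero_smul]
    simp [hr]

lemma LL_row_sum {n : ℕ} (q : ℝ) (v : Fin n) : ∑ u, LL n q v u = 0 := by
  simp only [LL, Finset.sum_apply]
  rw [Finset.sum_comm]
  refine Finset.sum_eq_zero fun u _ => ?_
  simp [← Finset.mul_sum]

lemma det_LL_move {n : ℕ} (q : ℝ) (r c : Fin n) :
    ((LL n q).updateRow r (Pi.single r 1)).det = ((LL n q).updateRow r (Pi.single c 1)).det := by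
  have h : ((LL n q).updateRow r (Pi.single r 1 - Pi.single c 1)).det = 0 := by
    rw [← Matrix.exists_mulVec_eq_zero_iff]
    refine ⟨fun _ => 1, ?_, ?_⟩
    · intro hc; simpa using congrFun hc r
    · ext v
      by_cases hv : v = r
      · subst hv; simp [Matrix.mulVec, dotProduct]
      · simp [Matrix.mulVec, dotProduct, Matrix.updateRow_ne hv, LL_row_sum]
  have h2 := Matrix.det_updateRow_add (LL n q) r (Pi.single r 1 - Pi.single c 1) (Pi.single c 1)
  rw [sub_add_cancel, h, zero_add] at h2
  exact h2

lemma treeWeight_eq_det (m : ℕ) (q : ℝ) :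
    treeWeight (m+1) q = ((LL (m+1) q).updateCol 0 (fun _ => 1)).det := by
  unfold treeWeight
  rw [Finset.sum_filter, Fintype.sum_prod_type]
  rw [← Matrix.cramer_apply, Matrix.cramer_eq_adjugate_mulVec, Matrix.mulVec, dotProduct]
  refine Finset.sum_congr rfl fun r _ => ?_
  rw [Matrix.adjugate_apply, mul_one, ← det_LL_move q r 0, det_LL_root]

lemma LL_off {n : ℕ} (q : ℝ) (v u : Fin n) (h : v ≠ u) : LL n q v u = - ww q v u := by
  simp [LL, Pi.single_apply, h.symm, Finset.sum_apply]

lemma LL_diag {m : ℕ} (q : ℝ) (v : Fin (m+1)) : LL (m+1) q v v = v + q * (m - v) := by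
  have h : LL (m+1) q v v = (∑ u, ww q v u) - 1 := by
    simp only [LL, Finset.sum_apply, Pi.smul_apply, Pi.sub_apply, Pi.single_eq_same, smul_eq_mul,
      mul_sub, mul_one, Finset.sum_sub_distrib]
    simp [Pi.single_apply, ww]
  rw [h]
  have h2 : ∑ u, ww q v u = ∑ u : Fin (m+1), (1 + (q-1) * (if v < u then 1 else 0)) := by
    refine Finset.sum_congr rfl fun u _ => ?_
    simp only [ww]; split_ifs <;> ring
  rw [h2, Finset.sum_add_distrib, ← Finset.mul_sum, Finset.sum_boole]
  have : (Finset.univ.filter (fun u => v < u)) = Finset.Ioi v := by ext; simp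
  rw [this, Fin.card_Ioi]
  have hv := v.2
  rw [show m + 1 - 1 - (v:ℕ) = m - v by omega, Nat.cast_sub (by omega)]
  simp
  ring

lemma treeWeight_succ (m : ℕ) (q : ℝ) :
    treeWeight (m+1) q = ∏ v : Fin m, (((v:ℕ):ℝ) + 1 + q * (m - (v:ℕ))) := by
  rw [treeWeight_eq_det]
  let A := (LL (m+1) q).updateCol 0 (fun _ => 1)
  let B : Matrix (Fin (m+1)) (Fin (m+1)) ℝ :=
    fun i j => Fin.cases (A 0 j) (fun k => A k.succ j - A k.castSucc j) i
  have hAB : A.det = B.det := by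
    refine Matrix.det_eq_of_forall_row_eq_smul_add_pred (fun _ => 1) (fun j => rfl) ?_
    intro i j
    simp [B]
  change A.det = _
  rw [hAB, Matrix.det_succ_column_zero, Fin.sum_univ_succ]
  have h0 : B 0 0 = 1 := by simp [B, A]
  have hs : ∀ i : Fin m, B i.succ 0 = 0 := by intro i; simp [B, A]
  have hB : ∀ i j : Fin m, B i.succ j.succ = LL (m+1) q i.succ j.succ - LL (m+1) q i.castSucc j.succ := by
    intro i j
    simp [B, A]
  simp only [hs, h0, mul_zero, zero_mul, Finset.sum_const_zero, add_zero, Fin.val_zero, pow_zero,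
    one_mul]
  rw [Matrix.det_of_isLowerTriangular]
  · refine Finset.prod_congr rfl fun v _ => ?_
    simp only [Matrix.submatrix_apply, Fin.zero_succAbove]
    rw [hB, LL_diag, LL_off _ _ _ (Fin.castSucc_lt_succ).ne, ww, if_pos (Fin.castSucc_lt_succ)]
    simp
    ring
  · intro i j hij
    have hij' : i < j := hij
    simp only [Matrix.submatrix_apply, Fin.zero_succAbove]
    have h1 : i.succ < j.succ := Fin.succ_lt_succ_iff.mpr hij'
    have h2 : i.castSucc < j.succ := Fin.castSucc_lt_succ.trans h1
    rw [hB, LL_off _ _ _ h1.ne, LL_off _ _ _ h2.ne, ww, ww, if_pos h1, if_pos h2]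
    ring

noncomputable def dd (h : ℝ) (n : ℕ) (t : ℝ) : ℝ :=
  if n = 0 then 0 else (∏ i ∈ Finset.range (n-1), (t + n - (i+1)*h)) / (n.factorial : ℝ)

noncomputable def ff (h : ℝ) (n : ℕ) (t : ℝ) : ℝ := (if n = 0 then 1 else 0) + t * dd h n t

lemma ff_zero (h t : ℝ) : ff h 0 t = 1 := by simp [ff, dd]

lemma ff_at_zero (h : ℝ) (n : ℕ) : ff h n 0 = if n = 0 then 1 else 0 := by simp [ff]

lemma ff_rec (h : ℝ) (n : ℕ) (t : ℝ) : ff h (n+1) (t+h) - ff h (n+1) t = h * ff h n (t+1) := by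
  rcases n with _ | n
  · simp [ff, dd]
  · simp only [ff, dd, Nat.add_sub_cancel, Nat.add_eq_zero_iff, one_ne_zero, and_false, if_false]
    rw [Finset.prod_range_succ' (fun i : ℕ => (t + h + ((n+1+1 : ℕ):ℝ) - ((i:ℝ)+1)*h)),
      Finset.prod_range_succ]
    have e1 : ∀ i ∈ Finset.range n, (t + h + ((n+1+1 : ℕ):ℝ) - (((i+1 : ℕ):ℝ)+1)*h)
        = t + 1 + ((n+1:ℕ):ℝ) - ((i:ℝ)+1)*h := by
      intro i _; push_cast; ring
    have e2 : ∀ i ∈ Finset.range n, (t + ((n+1+1 : ℕ):ℝ) - ((i:ℝ)+1)*h)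
        = t + 1 + ((n+1:ℕ):ℝ) - ((i:ℝ)+1)*h := by
      intro i _; push_cast; ring
    rw [Finset.prod_congr rfl e1, Finset.prod_congr rfl e2]
    generalize (∏ i ∈ Finset.range n, (t + 1 + ((n+1:ℕ):ℝ) - ((i:ℝ)+1)*h)) = Q
    rw [Nat.factorial_succ (n+1)]
    have h1 : ((n+1).factorial : ℝ) ≠ 0 := by positivity
    have h2 : ((n:ℝ)+1+1) ≠ 0 := by positivity
    push_cast
    field_simp
    ring

lemma ff_poly (h : ℝ) (n : ℕ) : ∃ p : Polynomial ℝ, ∀ t, p.eval t = ff h n t := by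
  by_cases hn : n = 0
  · exact ⟨1, fun t => by simp [ff, dd, hn]⟩
  · refine ⟨Polynomial.X * ((∏ i ∈ Finset.range (n-1),
      (Polynomial.X + Polynomial.C ((n:ℝ) - (i+1)*h))) * Polynomial.C ((n.factorial : ℝ)⁻¹)),
      fun t => ?_⟩
    simp [ff, dd, hn, Polynomial.eval_prod, div_eq_mul_inv, add_sub_assoc]

lemma poly_periodic (h : ℝ) (hh : h ≠ 0) (p : Polynomial ℝ)
    (hp : ∀ s, p.eval (s+h) = p.eval s) (h0 : p.eval 0 = 0) : p = 0 := by
  apply Polynomial.eq_zero_of_infinite_isRoot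
  have hk : ∀ k : ℕ, p.eval ((k:ℝ)*h) = 0 := by
    intro k
    induction k with
    | zero => simpa using h0
    | succ k ih => rw [← ih, ← hp (k*h)]; congr 1; push_cast; ring
  refine Set.infinite_of_injective_forall_mem (f := fun k : ℕ => (k:ℝ)*h) ?_ hk
  intro a b hab
  exact_mod_cast mul_right_cancel₀ hh hab

lemma ff_conv (h : ℝ) (hh : h ≠ 0) (n : ℕ) : ∀ s t : ℝ,
    ∑ k ∈ Finset.HasAntidiagonal.antidiagonal n, ff h k.1 s * ff h k.2 t = ff h n (s+t) := by
  induction n with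
  | zero => intro s t; simp [ff_zero]
  | succ n ih =>
    intro s t
    choose P hP using ff_poly h
    have key := poly_periodic h hh (∑ k ∈ Finset.HasAntidiagonal.antidiagonal (n+1),
      P k.1 * Polynomial.C (ff h k.2 t) - (P (n+1)).comp (Polynomial.X + Polynomial.C t)) ?_ ?_
    · have := congrArg (Polynomial.eval s) key
      simp [Polynomial.eval_finsetSum, hP] at this
      linarith
    · intro s
      simp only [Polynomial.eval_sub, Polynomial.eval_finsetSum, Polynomial.eval_mul, hP,
        Polynomial.eval_C, Polynomial.eval_comp, Polynomial.eval_add, Polynomial.eval_X]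
      rw [Finset.Nat.sum_antidiagonal_succ, Finset.Nat.sum_antidiagonal_succ]
      have e : ∀ k ∈ Finset.HasAntidiagonal.antidiagonal n, ff h (k.1+1) (s+h) * ff h k.2 t =
          ff h (k.1+1) s * ff h k.2 t + h * (ff h k.1 (s+1) * ff h k.2 t) := by
        intro k _
        linear_combination (ff h k.2 t) * ff_rec h k.1 s
      rw [Finset.sum_congr rfl e, Finset.sum_add_distrib, ← Finset.mul_sum, ih]
      have := ff_rec h n (s+t)
      rw [show s + h + t = s + t + h by ring, show s + 1 + t = s + t + 1 by ring]
      simp only [ff_zero]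
      linarith
    · simp only [Polynomial.eval_sub, Polynomial.eval_finsetSum, Polynomial.eval_mul, hP,
        Polynomial.eval_C, Polynomial.eval_comp, Polynomial.eval_add, Polynomial.eval_X]
      rw [Finset.Nat.sum_antidiagonal_succ]
      simp [ff_at_zero]

lemma dd_bound (h : ℝ) (n : ℕ) (t : ℝ) (ht : |t| ≤ 1 + |h|) :
    |dd h n t| ≤ (2 * (1+|h|) * Real.exp 1)^n := by
  have hT : 0 ≤ |h| := abs_nonneg h
  by_cases hn : n = 0
  · simp [dd, hn]
  have hn1 : (1:ℝ) ≤ n := by exact_mod_cast Nat.one_le_iff_ne_zero.mpr hn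
  simp only [dd, hn, if_false]
  rw [abs_div, Finset.abs_prod, abs_of_pos (show (0:ℝ) < n.factorial by positivity)]
  have h1 : ∏ i ∈ Finset.range (n-1), |t + n - (i+1)*h| ≤ (2 * (1+|h|) * n)^(n-1) := by
    rw [← Finset.card_range (n-1), ← Finset.prod_const, Finset.card_range]
    refine Finset.prod_le_prod (fun _ _ => abs_nonneg _) ?_
    intro i hi
    have hi' : ((i:ℝ)+1) ≤ n := by
      have := Finset.mem_range.mp hi
      exact_mod_cast (by omega : i + 1 ≤ n)
    calc |t + n - (i+1)*h| ≤ |t| + |(n:ℝ)| + |((i:ℝ)+1)*h| := by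
          refine (abs_sub _ _).trans ?_
          gcongr; exact abs_add_le _ _
      _ = |t| + n + (i+1) * |h| := by
          rw [abs_mul, abs_of_pos (show (0:ℝ) < i + 1 by positivity), Nat.abs_cast]
      _ ≤ (1 + |h|) * n + n + n * |h| := by
          gcongr
          nlinarith
      _ = 2 * (1+|h|) * n := by ring
  have h2 : (2 * (1+|h|) * n)^(n-1) ≤ (2 * (1+|h|) * n)^n :=
    pow_le_pow_right₀ (by nlinarith) (Nat.sub_le _ _)
  have h3 : (n:ℝ)^n / n.factorial ≤ Real.exp n := Real.pow_div_factorial_le_exp _ (by positivity) n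
  calc _ ≤ (2 * (1+|h|) * n)^n / (n.factorial : ℝ) := by gcongr; exact h1.trans h2
    _ = (2 * (1+|h|))^n * ((n:ℝ)^n / n.factorial) := by rw [mul_pow]; ring
    _ ≤ (2 * (1+|h|))^n * Real.exp n := by gcongr
    _ = _ := by rw [mul_pow _ (Real.exp 1), ← Real.exp_nat_mul, mul_one]

lemma dd_bound' (h x : ℝ) (hx : |x| < 1 / (2 * (2 * (1+|h|) * Real.exp 1)))
    (n : ℕ) (t : ℝ) (ht : |t| ≤ 1 + |h|) :
    ‖dd h n t * x ^ n‖ ≤ (1/2)^n := by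
  rw [Real.norm_eq_abs, abs_mul, abs_pow]
  have hK : 0 < 2 * (1+|h|) * Real.exp 1 := by positivity
  calc _ ≤ (2 * (1+|h|) * Real.exp 1)^n * (1 / (2 * (2 * (1+|h|) * Real.exp 1)))^n := by
        gcongr; exact dd_bound h n t ht
    _ = _ := by rw [← mul_pow]; congr 1; field_simp

lemma ff_summable (h x : ℝ) (hx : |x| < 1 / (2 * (2 * (1+|h|) * Real.exp 1)))
    (t : ℝ) (ht : |t| ≤ 1 + |h|) : Summable (fun n => ‖ff h n t * x ^ n‖) := by
  refine Summable.of_nonneg_of_le (fun _ => norm_nonneg _) (f := fun n => (1/2)^n + |t| * (1/2)^n)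
    ?_ (summable_geometric_two.add (summable_geometric_two.mul_left _))
  intro n
  have := dd_bound' h x hx n t ht
  rw [ff, add_mul, mul_assoc]
  refine (norm_add_le _ _).trans ?_
  rw [norm_mul t, Real.norm_eq_abs t]
  gcongr
  split_ifs with hn <;> simp [hn]

noncomputable def EE (h x t : ℝ) : ℝ := ∑' n, ff h n t * x ^ n

lemma EE_mul (h : ℝ) (hh : h ≠ 0) (x : ℝ) (hx : |x| < 1 / (2 * (2 * (1+|h|) * Real.exp 1)))
    (s t : ℝ) (hs : |s| ≤ 1 + |h|) (ht : |t| ≤ 1 + |h|) :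
    EE h x s * EE h x t = EE h x (s+t) := by
  unfold EE
  rw [tsum_mul_tsum_eq_tsum_sum_antidiagonal_of_summable_norm (ff_summable h x hx s hs)
    (ff_summable h x hx t ht)]
  congr 1; ext n
  rw [← ff_conv h hh, Finset.sum_mul]
  refine Finset.sum_congr rfl fun k hk => ?_
  rw [← Finset.HasAntidiagonal.mem_antidiagonal.mp hk, pow_add]; ring

noncomputable def DD (h x t : ℝ) : ℝ := ∑' n, dd h n t * x ^ n

lemma dd_summable (h x : ℝ) (hx : |x| < 1 / (2 * (2 * (1+|h|) * Real.exp 1)))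
    (t : ℝ) (ht : |t| ≤ 1 + |h|) : Summable (fun n => dd h n t * x ^ n) :=
  Summable.of_norm_bounded summable_geometric_two (fun n => dd_bound' h x hx n t ht)

lemma EE_eq (h x : ℝ) (hx : |x| < 1 / (2 * (2 * (1+|h|) * Real.exp 1)))
    (t : ℝ) (ht : |t| ≤ 1 + |h|) : EE h x t = 1 + t * DD h x t := by
  unfold EE DD
  rw [← (ff_summable h x hx t ht).of_norm.sum_add_tsum_nat_add 1,
    ← (dd_summable h x hx t ht).sum_add_tsum_nat_add 1]
  simp [ff, dd, ← tsum_mul_left, mul_assoc]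

lemma DD_tendsto (h x : ℝ) (hx : |x| < 1 / (2 * (2 * (1+|h|) * Real.exp 1))) :
    Filter.Tendsto (DD h x) (nhds 0) (nhds (DD h x 0)) := by
  unfold DD
  refine tendsto_tsum_of_dominated_convergence (bound := fun n => (1/2)^n)
    summable_geometric_two ?_ ?_
  · intro n
    have : Continuous (fun t => dd h n t * x ^ n) := by
      unfold dd
      split_ifs
      · fun_prop
      · fun_prop
    exact this.tendsto 0
  · have : ∀ᶠ t : ℝ in nhds 0, |t| < 1 + |h| := by
      have := (continuous_abs (G := ℝ)).tendsto 0
      refine this.eventually_lt_const ?_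
      rw [abs_zero]; positivity
    filter_upwards [this] with t ht n
    exact dd_bound' h x hx n t ht.le

lemma EE_exp (h : ℝ) (hh : h ≠ 0) (x : ℝ) (hx : |x| < 1 / (2 * (2 * (1+|h|) * Real.exp 1)))
    (t : ℝ) (ht : |t| ≤ 1 + |h|) : EE h x t = Real.exp (t * DD h x 0) := by
  have hpow : ∀ k : ℕ, 0 < k → (1 + (t * DD h x (t / k)) / k)^k = EE h x t := by
    intro k hk
    have hk' : (0:ℝ) < k := by exact_mod_cast hk
    have hb : ∀ j : ℕ, j ≤ k → |(j:ℝ) * (t / k)| ≤ 1 + |h| := by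
      intro j hj
      refine le_trans ?_ ht
      rw [abs_mul, abs_div, abs_of_pos hk', Nat.abs_cast]
      have : (j:ℝ) ≤ k := by exact_mod_cast hj
      rw [mul_div_assoc', div_le_iff₀ hk', mul_comm]
      gcongr
    have h1 : |t / k| ≤ 1 + |h| := by simpa using hb 1 hk
    have hj : ∀ j : ℕ, j ≤ k → (EE h x (t/k))^j = EE h x (j * (t/k)) := by
      intro j
      induction j with
      | zero => intro _; rw [EE_eq h x hx _ (hb 0 (by omega))]; simp
      | succ j ih =>
        intro hj
        rw [pow_succ, ih (by omega), EE_mul h hh x hx _ _ (hb j (by omega)) h1]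
        congr 1; push_cast; ring
    have h2 := hj k le_rfl
    rw [mul_div_cancel₀ _ hk'.ne'] at h2
    rw [← h2, EE_eq h x hx _ h1]
    congr 2; ring
  have hlim : Filter.Tendsto (fun k : ℕ => (1 + (t * DD h x (t / k)) / k)^k) Filter.atTop
      (nhds (Real.exp (t * DD h x 0))) := by
    apply Real.tendsto_one_add_pow_exp_of_tendsto
    have : Filter.Tendsto (fun k : ℕ => t * DD h x (t / k)) Filter.atTop (nhds (t * DD h x 0)) := by
      refine Filter.Tendsto.const_mul _ ((DD_tendsto h x hx).comp ?_)
      exact tendsto_const_div_atTop_nhds_zero_nat t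
    refine this.congr' ?_
    filter_upwards [Filter.eventually_gt_atTop 0] with k hk
    have : (k:ℝ) ≠ 0 := by positivity
    field_simp
  refine tendsto_nhds_unique (Filter.Tendsto.congr' ?_ tendsto_const_nhds) hlim
  filter_upwards [Filter.eventually_gt_atTop 0] with k hk
  exact (hpow k hk).symm

lemma EE_implicit (h : ℝ) (x : ℝ) (hx : |x| < 1 / (2 * (2 * (1+|h|) * Real.exp 1))) :
    EE h x h = 1 + h * x * EE h x 1 := by
  unfold EE
  rw [← (ff_summable h x hx h (by linarith)).of_norm.sum_add_tsum_nat_add 1, ← tsum_mul_left]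
  simp only [Finset.range_one, Finset.sum_singleton, ff_zero, pow_zero, mul_one]
  congr 2; ext n
  have := ff_rec h n 0
  rw [ff_at_zero] at this
  simp at this
  rw [this, pow_succ]; ring

lemma DD_implicit (q x : ℝ) (hq1 : q ≠ 1)
    (hx : |x| < 1 / (2 * (2 * (1+|1-q|) * Real.exp 1))) :
    x = (Real.exp (-q * DD (1-q) x 0) - Real.exp (-(DD (1-q) x 0))) / (1 - q) := by
  have hh : 1 - q ≠ 0 := sub_ne_zero.mpr hq1.symm
  have h1 := EE_implicit (1-q) x hx
  rw [EE_exp _ hh x hx _ (by linarith), EE_exp _ hh x hx 1 (by simp)] at h1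
  set a := DD (1-q) x 0
  rw [eq_div_iff hh]
  have e1 : Real.exp (-q * a) = Real.exp (-a) * Real.exp ((1-q)*a) := by
    rw [← Real.exp_add]; congr 1; ring
  have e2 : Real.exp (-a) * Real.exp (1*a) = 1 := by
    rw [← Real.exp_add]; simp
  rw [e1, h1]
  linear_combination -(1-q) * x * e2

lemma treeWeight_dd (n : ℕ) (q : ℝ) : treeWeight n q / (n.factorial : ℝ) = dd (1-q) n 0 := by
  rcases n with _ | m
  · simp [treeWeight, dd]
  · rw [treeWeight_succ, dd, if_neg (Nat.succ_ne_zero m), Nat.add_sub_cancel,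
      Fin.prod_univ_eq_prod_range (fun v : ℕ => ((v:ℝ) + 1 + q * (m - v))) m,
      ← Finset.prod_range_reflect]
    congr 1
    refine Finset.prod_congr rfl fun i hi => ?_
    have := Finset.mem_range.mp hi
    rw [show m - 1 - i = m - (i+1) by omega, Nat.cast_sub (by omega)]
    push_cast
    ring

/-- The exponential generating function `A(x,q) = Σ_{n≥1} Σ_{T ∈ 𝔗_n} q^{d(T)} x^n/n!`
satisfies, for `q ≠ 1`, the implicit equation `x = (e^{-qA} − e^{-A})/(1−q)` near `0`. -/
theorem tree_egf_implicit (q : ℝ) (hq : 0 < q) (hq1 : q ≠ 1) :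
    ∃ ε > 0, ∃ A : ℝ → ℝ, ∀ x : ℝ, |x| < ε →
      HasSum (fun n : ℕ => treeWeight n q * x ^ n / (n.factorial : ℝ)) (A x) ∧
      x = (Real.exp (-q * A x) - Real.exp (-(A x))) / (1 - q) := by
  refine ⟨1 / (2 * (2 * (1+|1-q|) * Real.exp 1)), by positivity, fun x => DD (1-q) x 0, ?_⟩
  intro x hx
  refine ⟨?_, DD_implicit q x hq1 hx⟩
  have h := (dd_summable (1-q) x hx 0 (by rw [abs_zero]; positivity)).hasSum
  refine h.congr_fun ?_ 
  intro n
  rw [← treeWeight_dd]; ring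
end

section
/- For every n ≥ 1 and q, the total weight of rooted labelled trees on n vertices counted by descents is n! [x^n] A(x,q) = ∏_{k=1}^{n-1} (n − k + kq); i.e., Σ_{T ∈ 𝔗_n} q^{d(T)} = ∏_{k=1}^{n-1} ((n−k) + kq). -/
open scoped Classical

namespace TW

noncomputable def W (n : ℕ) (q : ℝ) (v u : Fin n) : ℝ := if v < u then q else 1

noncomputable def L (n : ℕ) (q : ℝ) : Matrix (Fin n) (Fin n) ℝ :=
  fun v => ∑ u, W n q v u • (Pi.single v 1 - Pi.single u 1 : Fin n → ℝ)

noncomputable def B {n : ℕ} (r : Fin n) (p : Fin n → Fin n) : Matrix (Fin n) (Fin n) ℝ :=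
  fun v => if v = r then Pi.single r 1 else Pi.single v 1 - Pi.single (p v) 1

lemma weight_eq {n : ℕ} (q : ℝ) (p : Fin n → Fin n) :
    q ^ treeDescentNum p = ∏ v, W n q v (p v) := by
  unfold treeDescentNum W
  rw [Finset.prod_ite]
  simp

lemma det_B_tree {n : ℕ} (r : Fin n) (p : Fin n → Fin n) (h : IsRootedTree r p) :
    (B r p).det = 1 := by
  obtain ⟨h1, h2⟩ := h
  let dep : Fin n → ℕ := fun v => Nat.find (h2 v)
  have hdep : ∀ v, v ≠ r → dep (p v) < dep v := by
    intro v hv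
    have hs : p^[dep v] v = r := Nat.find_spec (h2 v)
    rcases hk : dep v with _ | k
    · rw [hk] at hs
      exact absurd hs hv
    · rw [hk, Function.iterate_succ_apply] at hs
      exact Nat.lt_succ_of_le (Nat.find_min' (h2 (p v)) hs)
  have hB : ∀ i j, i ≠ j → B r p i j ≠ 0 → dep j < dep i := by
    intro i j hij hne
    unfold B at hne
    by_cases hi : i = r
    · subst hi
      simp [Pi.single_apply, hij.symm] at hne
    · by_cases hj : j = p i
      · rw [hj]; exact hdep i hi
      · simp [hi, Pi.single_apply, hij.symm, hj] at hne
  have hdiag : ∀ i, B r p i i = 1 := by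
    intro i
    unfold B
    by_cases hi : i = r
    · subst hi; simp
    · have : i ≠ p i := by
        intro h
        have := hdep i hi
        rw [← h] at this
        exact lt_irrefl _ this
      simp [hi, Pi.single_apply, this]
  have hbt : (B r p).BlockTriangular (fun v => OrderDual.toDual (dep v)) := by
    intro i j hij
    by_contra hne
    have hij' : dep i < dep j := hij
    have : i ≠ j := by rintro rfl; exact lt_irrefl _ hij'
    exact absurd (hB i j this hne) (by omega)
  rw [hbt.det]
  apply Finset.prod_eq_one
  intro a _
  have : (B r p).toSquareBlock (fun v => OrderDual.toDual (dep v)) a = 1 := by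
    ext ⟨i, hi⟩ ⟨j, hj⟩
    simp only [Matrix.toSquareBlock_def, Matrix.of_apply, Matrix.one_apply, Subtype.mk.injEq]
    split_ifs with hij
    · subst hij; exact hdiag i
    · by_contra hne
      have h3 := hB i j hij hne
      have h4 : dep i = dep j := OrderDual.toDual.injective (hi.trans hj.symm)
      omega
  rw [this, Matrix.det_one]

lemma det_B_not {n : ℕ} (r : Fin n) (p : Fin n → Fin n) (hr : p r = r)
    (h : ¬ IsRootedTree r p) : (B r p).det = 0 := by
  have h' : ∃ v, ∀ k, p^[k] v ≠ r := by
    by_contra hc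
    push Not at hc
    exact h ⟨hr, hc⟩
  obtain ⟨v, hv⟩ := h'
  rw [← Matrix.exists_mulVec_eq_zero_iff]
  refine ⟨fun u => if ∀ k, p^[k] u ≠ r then 1 else 0, ?_, ?_⟩
  · intro h0
    have := congrFun h0 v
    simp [hv] at this
  · ext u
    unfold B
    by_cases hu : u = r
    · subst hu
      simp only [Matrix.mulVec, if_true, single_dotProduct, Pi.zero_apply, one_mul]
      rw [if_neg]
      intro hk
      exact hk 0 rfl
    · simp only [Matrix.mulVec, if_neg hu, sub_dotProduct, single_dotProduct, Pi.zero_apply,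
        one_mul]
      have : (∀ k, p^[k] u ≠ r) ↔ (∀ k, p^[k] (p u) ≠ r) := by
        constructor
        · intro h k
          exact h (k+1)
        · intro h k
          cases k with
          | zero => exact hu
          | succ k => exact h k
      simp only [this, sub_self]

lemma adj_diag {n : ℕ} (q : ℝ) (r : Fin n) :
    (L n q).adjugate r r =
      ∑ p : Fin n → Fin n, if IsRootedTree r p then ∏ v, W n q v (p v) else 0 := by
  rw [Matrix.adjugate_apply]
  let k : Fin n → Fin n → ℝ := fun v u => if v = r then (if u = r then 1 else 0) else W n q v u
  let b : Fin n → Fin n → (Fin n → ℝ) := fun v u =>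
    if v = r then Pi.single r 1 else Pi.single v 1 - Pi.single u 1
  have hM : (L n q).updateRow r (Pi.single r 1) = fun v => ∑ u, k v u • b v u := by
    funext v
    by_cases hv : v = r
    · subst hv
      simp [k, b, ite_smul]
    · ext j
      rw [Matrix.updateRow_ne hv]
      simp [k, b, hv, L]
  rw [hM]
  have := (Matrix.detRowAlternating (R := ℝ) (n := Fin n)).toMultilinearMap.map_sum
    (fun v u => k v u • b v u)
  refine Eq.trans this ?_
  apply Finset.sum_congr rfl
  intro p _
  refine Eq.trans ((Matrix.detRowAlternating (R := ℝ) (n := Fin n)).toMultilinearMap.map_smul_univ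
    (fun v => k v (p v)) (fun v => b v (p v))) ?_
  change (∏ v, k v (p v)) • (B r p).det = _
  by_cases hr : p r = r
  · have hk : ∏ v, k v (p v) = ∏ v, W n q v (p v) := by
      apply Finset.prod_congr rfl
      intro v _
      by_cases hv : v = r
      · subst hv; simp [k, hr, W]
      · simp [k, hv]
    split_ifs with ht
    · rw [det_B_tree r p ht, hk]; simp
    · rw [det_B_not r p hr ht]; simp
  · rw [if_neg (fun h => hr h.1), Finset.prod_eq_zero (Finset.mem_univ r)]
    · simp
    · simp [k, hr]

lemma L_one {n : ℕ} (q : ℝ) (v : Fin n) : L n q v ⬝ᵥ (fun _ => 1) = 0 := by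
  simp [L, sum_dotProduct, sub_dotProduct]

lemma adj_const {n : ℕ} (q : ℝ) (r s : Fin n) :
    (L n q).adjugate r r = (L n q).adjugate s r := by
  rw [Matrix.adjugate_apply, Matrix.adjugate_apply, ← sub_eq_zero]
  have h : ((L n q).updateRow r (Pi.single r 1 + (-1 : ℝ) • Pi.single s 1)).det = 0 := by
    rw [← Matrix.exists_mulVec_eq_zero_iff]
    refine ⟨fun _ => 1, ?_, ?_⟩
    · intro h0
      simpa using congrFun h0 r
    · ext v
      by_cases hv : v = r
      · subst hv
        simp only [Matrix.mulVec, Matrix.updateRow_self]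
        rw [add_dotProduct, smul_dotProduct]
        simp
      · simp only [Matrix.mulVec, Matrix.updateRow_ne hv]
        exact L_one q v
  rw [Matrix.det_updateRow_add, Matrix.det_updateRow_smul] at h
  simpa [sub_eq_add_neg] using h

lemma treeWeight_det (m : ℕ) (q : ℝ) :
    treeWeight (m+1) q = ((L (m+1) q).updateCol 0 (fun _ => 1)).det := by
  unfold treeWeight
  rw [Finset.sum_filter, Fintype.sum_prod_type]
  simp only [weight_eq]
  rw [← Matrix.cramer_apply, Matrix.cramer_eq_adjugate_mulVec]
  simp only [Matrix.mulVec, dotProduct, mul_one]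
  apply Finset.sum_congr rfl
  intro r _
  rw [← adj_const, adj_diag]

lemma L_apply_ne {n : ℕ} (q : ℝ) {v u : Fin n} (h : v ≠ u) : L n q v u = - W n q v u := by
  simp [L, Pi.single_apply, h.symm, Finset.sum_apply]

lemma L_apply_self {m : ℕ} (q : ℝ) (v : Fin (m+1)) :
    L (m+1) q v v = v + (m - v) * q := by
  have h : L (m+1) q v v = ∑ u, (W (m+1) q v u - if v = u then 1 else 0) := by
    simp only [L, Finset.sum_apply]
    apply Finset.sum_congr rfl
    intro u _
    by_cases h : v = u
    · subst h; simp [W]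
    · simp [Pi.single_apply, h]
  rw [h, Finset.sum_sub_distrib]
  simp only [W, Finset.sum_ite_eq, Finset.mem_univ, if_true]
  rw [Finset.sum_ite]
  have h1 : (Finset.univ.filter (fun u => v < u)) = Finset.Ioi v := by ext; simp
  have h2 : (Finset.univ.filter (fun u => ¬ v < u)) = Finset.Iic v := by ext; simp
  rw [h1, h2]
  simp only [Finset.sum_const, Fin.card_Ioi, Fin.card_Iic, nsmul_eq_mul]
  have : (v : ℕ) ≤ m := by omega
  rw [show m + 1 - 1 - (v : ℕ) = m - v by omega, Nat.cast_sub this]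
  push_cast
  ring

lemma L_diff {m : ℕ} (q : ℝ) (i : Fin m) (j : Fin (m+1)) :
    L (m+1) q i.succ j - L (m+1) q i.castSucc j =
      (if j = i.succ then ((i : ℝ) + 1 + (m - i) * q) else 0) -
      (if j = i.castSucc then ((i : ℝ) + 1 + (m - i) * q) else 0) := by
  have hlt : i.castSucc < i.succ := Fin.castSucc_lt_succ
  by_cases h1 : j = i.succ
  · subst h1
    rw [L_apply_self, L_apply_ne q hlt.ne, if_pos rfl, if_neg hlt.ne', W, if_pos hlt]
    simp
    ring
  · by_cases h2 : j = i.castSucc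
    · subst h2
      rw [L_apply_self, L_apply_ne q hlt.ne', if_pos rfl, if_neg hlt.ne, W, if_neg hlt.not_gt]
      simp
      ring
    · rw [L_apply_ne q (Ne.symm h1), L_apply_ne q (Ne.symm h2), if_neg h1, if_neg h2, W, W]
      have : i.succ < j ↔ i.castSucc < j := by
        simp only [Fin.ext_iff, Fin.lt_def, Fin.val_succ, Fin.val_castSucc] at *
        omega
      simp [this]

lemma det_eq (m : ℕ) (q : ℝ) :
    ((L (m+1) q).updateCol 0 (fun _ => 1)).det = ∏ i : Fin m, ((i : ℝ) + 1 + (m - i) * q) := by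
  set A := (L (m+1) q).updateCol 0 (fun _ => 1) with hA
  let C : Matrix (Fin (m+1)) (Fin (m+1)) ℝ :=
    Fin.cons (A 0) (fun i : Fin m => A i.succ - A i.castSucc)
  have hAC : A.det = C.det := by
    apply Matrix.det_eq_of_forall_row_eq_smul_add_pred (fun _ => 1)
    · intro j; simp [C]
    · intro i j; simp [C]
  rw [hAC, Matrix.det_succ_column_zero, Fin.sum_univ_succ]
  have h0 : C 0 0 = 1 := by simp [C, hA]
  have hs : ∀ i : Fin m, C i.succ 0 = 0 := by intro i; simp [C, hA]
  simp only [h0, hs]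
  have hsub : ∀ i j : Fin m, C i.succ j.succ = 
      (if j.succ = i.succ then ((i : ℝ) + 1 + (m - i) * q) else 0) -
      (if j.succ = i.castSucc then ((i : ℝ) + 1 + (m - i) * q) else 0) := by
    intro i j
    rw [← L_diff]
    simp [C, hA, Matrix.updateCol_ne (Fin.succ_ne_zero j)]
  simp only [Fin.val_zero, pow_zero, one_mul, mul_zero, zero_mul, Finset.sum_const_zero, add_zero]
  rw [Matrix.det_of_isLowerTriangular]
  · apply Finset.prod_congr rfl
    intro i _
    simp only [Matrix.submatrix_apply, Fin.succAbove_zero, hsub]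
    rw [if_neg (Fin.castSucc_lt_succ).ne', sub_zero]
    simp
  · intro i j hij
    have hij' : i < j := hij
    simp only [Matrix.submatrix_apply, Fin.succAbove_zero, hsub]
    rw [if_neg, if_neg, sub_zero]
    · simp only [Fin.ext_iff, Fin.lt_def, Fin.val_succ, Fin.val_castSucc] at *
      omega
    · simp only [Fin.ext_iff, Fin.lt_def, Fin.val_succ] at *
      omega

end TW

/-- `Σ_{T ∈ 𝔗_n} q^{d(T)} = ∏_{k=1}^{n-1} ((n−k) + kq)`. -/
theorem treeWeight_prod (q : ℝ) (n : ℕ) (hn : 1 ≤ n) :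
    treeWeight n q = ∏ k ∈ Finset.Icc 1 (n - 1), ((n : ℝ) - k + k * q) := by
  obtain ⟨m, rfl⟩ : ∃ m, n = m + 1 := ⟨n - 1, by omega⟩
  rw [TW.treeWeight_det, TW.det_eq, Fin.prod_univ_eq_prod_range
    (fun i : ℕ => ((i : ℝ) + 1 + (m - i) * q)) m]
  apply Finset.prod_bij' (fun i _ => m - i) (fun k _ => m - k)
  · intro i hi
    simp at hi ⊢
    omega
  · intro k hk
    simp at hk ⊢
    omega
  · intro i hi
    simp at hi ⊢
    omega
  · intro k hk
    simp at hk ⊢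
    omega
  · intro i hi
    simp at hi
    rw [Nat.cast_sub hi.le]
    push_cast
    ring
end
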